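/- arXiv:1605.02728 — 2 statements merged into one kernel-verified Lean document; each statement's English description precedes it below -/
import Mathlib

section
/- For 0 < q < 1, ∑_{n=0}^∞ q^{n²}/(q;q)_{2n} = 1/((q;q²)_∞ · (q⁴;q²⁰)_∞ · (q¹⁶;q²⁰)_∞). -/
noncomputable def qp (q a : ℝ) (n : ℕ) : ℝ := ∏ k ∈ Finset.range n, (1 - a * q ^ k)

noncomputable def qpi (q a : ℝ) : ℝ := ∏' k : ℕ, (1 - a * q ^ k)

noncomputable def ww (p : ℝ) (k : ℤ) : ℝ := if k < 0 then 0 else 1 / qp p p k.toNat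

lemma qp_succ (p a : ℝ) (n : ℕ) : qp p a (n + 1) = qp p a n * (1 - a * p ^ n) := by
  simp [qp, Finset.prod_range_succ]

lemma qp_zero (p a : ℝ) : qp p a 0 = 1 := by simp [qp]

lemma one_sub_pos_aux {p a : ℝ} (hp0 : 0 < p) (hp1 : p < 1) (ha : a < 1) (k : ℕ) :
    0 < 1 - a * p ^ k := by
  have h1 : p ^ k ≤ 1 := pow_le_one₀ hp0.le hp1.le
  have h2 : 0 < p ^ k := by positivity
  rcases le_or_gt a 0 with h | h
  · nlinarith
  · nlinarith

lemma qp_pos {p a : ℝ} (hp0 : 0 < p) (hp1 : p < 1) (ha : a < 1) (n : ℕ) : 0 < qp p a n :=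
  Finset.prod_pos fun k _ => one_sub_pos_aux hp0 hp1 ha k

lemma ww_neg (p : ℝ) {k : ℤ} (hk : k < 0) : ww p k = 0 := by simp [ww, hk]

lemma ww_nat (p : ℝ) (k : ℕ) : ww p (k : ℤ) = 1 / qp p p k := by
  simp [ww]

lemma ww_zero (p : ℝ) : ww p 0 = 1 := by simp [ww, qp_zero]

lemma ww_pred {p : ℝ} (hp0 : 0 < p) (hp1 : p < 1) (k : ℤ) :
    ww p (k - 1) = (1 - p ^ k) * ww p k := by
  rcases lt_trichotomy k 0 with h | h | h
  · rw [ww_neg p h, ww_neg p (by omega)]; simp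
  · subst h; rw [ww_neg p (by omega)]; simp
  · obtain ⟨n, rfl⟩ : ∃ n : ℕ, k = n + 1 := ⟨(k - 1).toNat, by omega⟩
    have : ((n : ℤ) + 1 - 1) = (n : ℤ) := by ring
    rw [this, ww_nat]
    have e : ((n : ℤ) + 1) = ((n + 1 : ℕ) : ℤ) := by push_cast; ring
    rw [e, ww_nat, qp_succ, zpow_natCast]
    have h1 := (qp_pos hp0 hp1 hp1 n).ne'
    have h2 := (one_sub_pos_aux hp0 hp1 hp1 n).ne'
    have h3 : 1 - p ^ (n + 1) = 1 - p * p ^ n := by ring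
    rw [h3]
    field_simp

lemma tele {a b G : ℤ → ℝ} (h : ∀ j, a j - b j = G (j + 1) - G j)
    (ha : Summable a) (hb : Summable b) (hG : Summable G) : ∑' j, a j = ∑' j, b j := by
  have h1 : ∑' j, G (j + 1) = ∑' j, G j := (Equiv.addRight (1 : ℤ)).tsum_eq G
  have h2 : Summable fun j => G (j + 1) := (Equiv.addRight (1 : ℤ)).summable_iff.mpr hG
  have h3 : ∑' j, (a j - b j) = ∑' j, (G (j + 1) - G j) := tsum_congr h
  rw [ha.tsum_sub hb, h2.tsum_sub hG, h1] at h3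
  linarith

lemma summable_box {f : ℤ → ℝ} (N : ℕ) (h : ∀ j : ℤ, (N : ℤ) < j ∨ j < -N → f j = 0) :
    Summable f := by
  apply summable_of_ne_finset_zero (s := Finset.Icc (-(N : ℤ)) N)
  intro j hj
  apply h
  simp only [Finset.mem_Icc, not_and_or, not_le] at hj
  omega

/-! Finite triple product. -/
lemma jtp_fin {u v : ℝ} (hu0 : 0 < u) (hu1 : u < 1) (hv : v ≠ 0) (m : ℕ) :
    ∑' j : ℤ, (-1) ^ j * u ^ (j ^ 2) * v ^ j * (ww (u ^ 2) (m + j) * ww (u ^ 2) (m - j)) =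
      qp (u ^ 2) (u * v) m * qp (u ^ 2) (u / v) m / qp (u ^ 2) (u ^ 2) (2 * m) := by
  have hp0 : 0 < u ^ 2 := by positivity
  have hp1 : u ^ 2 < 1 := by nlinarith
  have hsum : ∀ (c : ℤ → ℝ) (n : ℕ), Summable fun j : ℤ =>
      c j * (ww (u ^ 2) (n + j) * ww (u ^ 2) (n - j)) := by
    intro c n
    apply summable_box n
    rintro j (hj | hj)
    · rw [ww_neg _ (show (n : ℤ) - j < 0 by omega)]; simp
    · rw [ww_neg _ (show (n : ℤ) + j < 0 by omega)]; simp
  induction m with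
  | zero =>
    rw [tsum_eq_single 0]
    · simp [ww_zero, qp_zero]
    · intro j hj
      rcases lt_or_gt_of_ne hj with h | h
      · rw [ww_neg _ (show ((0 : ℕ) : ℤ) + j < 0 by omega)]; simp
      · rw [ww_neg _ (show ((0 : ℕ) : ℤ) - j < 0 by omega)]; simp
  | succ m ih =>
    set p := u ^ 2 with hp
    set y : ℝ := p ^ (m + 1) with hy
    have hy0 : 0 < y := by positivity
    set G : ℤ → ℝ := fun j => (((y ^ 2 / u ^ 2 - y / (u * v)) + y * (y / (u * v) - 1) / p ^ j) *
      (1 - y * p ^ j) * ((-1) ^ j * u ^ (j ^ 2) * v ^ j)) *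
        (ww p ((m + 1 : ℕ) + j) * ww p ((m + 1 : ℕ) - j)) with hG
    have key := tele (a := fun j => ((1 - y ^ 2 / p) * (1 - y ^ 2)) *
        ((-1) ^ j * u ^ (j ^ 2) * v ^ j * (ww p ((m + 1 : ℕ) + j) * ww p ((m + 1 : ℕ) - j))))
      (b := fun j => ((1 - v * y / u) * (1 - y / (u * v))) *
        ((-1) ^ j * u ^ (j ^ 2) * v ^ j * (ww p (m + j) * ww p (m - j)))) (G := G) ?_ ?_ ?_ ?_
    · rw [tsum_mul_left, tsum_mul_left, ih] at key
      have e1 : 2 * (m + 1) = 2 * m + 1 + 1 := by ring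
      rw [e1, qp_succ, qp_succ, qp_succ, qp_succ]
      have f1 : (1 - y ^ 2 / p) = 1 - p * p ^ (2 * m) := by
        rw [hy]; field_simp; ring
      have f2 : (1 - y ^ 2) = 1 - p * p ^ (2 * m + 1) := by
        rw [hy]; ring
      have f3 : (1 - v * y / u) = 1 - u * v * p ^ m := by
        rw [hy, pow_succ, hp]; field_simp
      have f4 : (1 - y / (u * v)) = 1 - u / v * p ^ m := by
        rw [hy, pow_succ, hp]; field_simp
      rw [f1, f2, f3, f4] at key
      have g1 := (one_sub_pos_aux hp0 hp1 hp1 (2 * m)).ne'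
      have g2 := (one_sub_pos_aux hp0 hp1 hp1 (2 * m + 1)).ne'
      have g3 := (qp_pos hp0 hp1 hp1 (2 * m)).ne'
      rw [← mul_div_assoc, eq_div_iff g3] at key
      rw [eq_div_iff (by positivity)]
      linear_combination key
    · intro j
      have w1 : ww p (m + j) = (1 - y * p ^ j) * ww p ((m + 1 : ℕ) + j) := by
        have := ww_pred hp0 hp1 ((m + 1 : ℕ) + j)
        rw [zpow_add₀ hp0.ne', zpow_natCast] at this
        rw [← this]; congr 1; push_cast; ring
      have w2 : ww p (m - j) = (1 - y / p ^ j) * ww p ((m + 1 : ℕ) - j) := by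
        have := ww_pred hp0 hp1 ((m + 1 : ℕ) - j)
        rw [zpow_sub₀ hp0.ne', zpow_natCast] at this
        rw [← this]; congr 1; push_cast; ring
      have w3 : ww p ((m + 1 : ℕ) - (j + 1)) = (1 - y / p ^ j) * ww p ((m + 1 : ℕ) - j) := by
        rw [← w2]; congr 1; push_cast; ring
      have w4 : (1 - y * p ^ (j + 1)) * ww p ((m + 1 : ℕ) + (j + 1)) = ww p ((m + 1 : ℕ) + j) := by
        have := ww_pred hp0 hp1 ((m + 1 : ℕ) + (j + 1))
        rw [zpow_add₀ hp0.ne', zpow_natCast] at this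
        rw [← this]; congr 1; push_cast; ring
      have c1 : (-1 : ℝ) ^ (j + 1) = - (-1) ^ j := by
        rw [zpow_add₀ (by norm_num)]; simp
      have c2 : u ^ ((j + 1) ^ 2) = u ^ (j ^ 2) * (p ^ j * u) := by
        have : (j + 1) ^ 2 = j ^ 2 + ((2 : ℕ) * j + 1) := by push_cast; ring
        rw [this, zpow_add₀ hu0.ne', zpow_add₀ hu0.ne', zpow_mul, zpow_natCast, zpow_one]
      have c3 : v ^ (j + 1) = v ^ j * v := by rw [zpow_add₀ hv, zpow_one]
      have c4 : p ^ (j + 1) = p ^ j * p := by rw [zpow_add₀ hp0.ne', zpow_one]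
      have hG1 : G (j + 1) = ((y ^ 2 / u ^ 2 - y / (u * v)) + y * (y / (u * v) - 1) / (p ^ j * p)) *
          (-(-1) ^ j * (u ^ (j ^ 2) * (p ^ j * u)) * (v ^ j * v)) * (ww p ((m + 1 : ℕ) + j) *
            ((1 - y / p ^ j) * ww p ((m + 1 : ℕ) - j))) := by
        rw [hG]; simp only
        rw [← w4, ← w3, c1, c2, c3, c4]; ring
      rw [hG1, hG]
      simp only
      rw [w1, w2]
      have hx : 0 < p ^ j := by positivity
      generalize p ^ j = x at *
      generalize ww p ((m + 1 : ℕ) + j) = W1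
      generalize ww p ((m + 1 : ℕ) - j) = W2
      generalize (-1 : ℝ) ^ j = s
      generalize u ^ (j ^ 2) = t
      generalize v ^ j = r
      rw [hp]
      clear_value y
      field_simp
      ring
    · exact (hsum _ (m + 1)).mul_left _
    · exact (hsum _ m).mul_left _
    · exact hsum _ (m + 1)

/-! The Bailey pair C(1). -/
lemma bailey_c1 {p : ℝ} (hp0 : 0 < p) (hp1 : p < 1) (n : ℕ) :
    ∑' r : ℤ, (-1) ^ r * p ^ (3 * r ^ 2) * (p ^ r + 1 / p ^ r) *
      (ww p (n - 2 * r) * ww p (n + 2 * r)) = 2 / (qp p p n * qp (p ^ 2) p n) := by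
  have hpp0 : 0 < p ^ 2 := by positivity
  have hpp1 : p ^ 2 < 1 := by nlinarith
  have hsum : ∀ (c : ℤ → ℝ) (n : ℕ), Summable fun j : ℤ =>
      c j * (ww p (n - 2 * j) * ww p (n + 2 * j)) := by
    intro c n
    apply summable_box n
    rintro j (hj | hj)
    · rw [ww_neg _ (show (n : ℤ) - 2 * j < 0 by omega)]; simp
    · rw [ww_neg _ (show (n : ℤ) + 2 * j < 0 by omega)]; simp
  induction n with
  | zero =>
    rw [tsum_eq_single 0]
    · simp [ww_zero, qp_zero]; norm_num
    · intro j hj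
      rcases lt_or_gt_of_ne hj with h | h
      · rw [ww_neg _ (show ((0 : ℕ) : ℤ) + 2 * j < 0 by omega)]; simp
      · rw [ww_neg _ (show ((0 : ℕ) : ℤ) - 2 * j < 0 by omega)]; simp
  | succ n ih =>
    set y : ℝ := p ^ (n + 1) with hy
    have hy0 : 0 < y := by positivity
    set G : ℤ → ℝ := fun r => (-y / (p ^ r) ^ 3 * (1 - y * (p ^ r) ^ 2) *
        (1 - y * (p ^ r) ^ 2 / p) * ((-1) ^ r * p ^ (3 * r ^ 2))) *
        (ww p ((n + 1 : ℕ) - 2 * r) * ww p ((n + 1 : ℕ) + 2 * r)) with hG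
    have key := tele (a := fun r => ((1 - y) * (1 - y ^ 2 / p)) *
        ((-1) ^ r * p ^ (3 * r ^ 2) * (p ^ r + 1 / p ^ r) *
          (ww p ((n + 1 : ℕ) - 2 * r) * ww p ((n + 1 : ℕ) + 2 * r))))
      (b := fun r => (-1) ^ r * p ^ (3 * r ^ 2) * (p ^ r + 1 / p ^ r) *
          (ww p (n - 2 * r) * ww p (n + 2 * r))) (G := G) ?_ ?_ ?_ ?_
    · rw [tsum_mul_left, ih] at key
      rw [qp_succ, qp_succ]
      have f1 : (1 - y ^ 2 / p) = 1 - p * (p ^ 2) ^ n := by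
        rw [hy]; field_simp; ring
      have f2 : (1 - y) = 1 - p * p ^ n := by
        rw [hy]; ring
      rw [f1, f2] at key
      have g1 := (one_sub_pos_aux hp0 hp1 hp1 n).ne'
      have g2 := (one_sub_pos_aux hpp0 hpp1 hp1 n).ne'
      have g3 := (qp_pos hp0 hp1 hp1 n).ne'
      have g4 := (qp_pos hpp0 hpp1 hp1 n).ne'
      rw [eq_div_iff (by positivity)] at key
      rw [eq_div_iff (by positivity)]
      linear_combination key
    · intro r
      have x2 : p ^ (2 * r) = (p ^ r) ^ 2 := by
        rw [mul_comm, zpow_mul]; norm_cast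
      have w1 : ww p (n + 2 * r) = (1 - y * (p ^ r) ^ 2) * ww p ((n + 1 : ℕ) + 2 * r) := by
        have := ww_pred hp0 hp1 ((n + 1 : ℕ) + 2 * r)
        rw [zpow_add₀ hp0.ne', zpow_natCast, x2] at this
        rw [← this]; congr 1; push_cast; ring
      have w2 : ww p (n - 2 * r) = (1 - y / (p ^ r) ^ 2) * ww p ((n + 1 : ℕ) - 2 * r) := by
        have := ww_pred hp0 hp1 ((n + 1 : ℕ) - 2 * r)
        rw [zpow_sub₀ hp0.ne', zpow_natCast, x2] at this
        rw [← this]; congr 1; push_cast; ring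
      have w3 : ww p ((n + 1 : ℕ) - 2 * (r + 1)) =
          (1 - y / (p ^ r) ^ 2 / p) * ((1 - y / (p ^ r) ^ 2) * ww p ((n + 1 : ℕ) - 2 * r)) := by
        rw [← w2]
        have := ww_pred hp0 hp1 (n - 2 * r)
        have e : p ^ ((n : ℤ) - 2 * r) = y / (p ^ r) ^ 2 / p := by
          rw [zpow_sub₀ hp0.ne', zpow_natCast, x2, hy]; field_simp; ring
        rw [e] at this
        rw [← this]; congr 1; push_cast; ring
      have w4 : (1 - y * (p ^ (r + 1)) ^ 2) * (1 - y * (p ^ (r + 1)) ^ 2 / p) *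
          ww p ((n + 1 : ℕ) + 2 * (r + 1)) = ww p ((n + 1 : ℕ) + 2 * r) := by
        have x3 : p ^ (2 * (r + 1)) = (p ^ (r + 1)) ^ 2 := by
          rw [mul_comm, zpow_mul]; norm_cast
        have h1 := ww_pred hp0 hp1 ((n + 1 : ℕ) + 2 * (r + 1))
        have h2 := ww_pred hp0 hp1 ((n + 1 : ℕ) + 2 * (r + 1) - 1)
        rw [h1, zpow_sub₀ hp0.ne', zpow_add₀ hp0.ne', zpow_natCast, x3, zpow_one] at h2
        have : ((n + 1 : ℕ) : ℤ) + 2 * r = (n + 1 : ℕ) + 2 * (r + 1) - 1 - 1 := by ring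
        rw [this, h2]; ring
      have c1 : (-1 : ℝ) ^ (r + 1) = - (-1) ^ r := by
        rw [zpow_add₀ (by norm_num)]; simp
      have c2 : p ^ (3 * (r + 1) ^ 2) = p ^ (3 * r ^ 2) * ((p ^ r) ^ 6 * p ^ 3) := by
        have : 3 * (r + 1) ^ 2 = 3 * r ^ 2 + (r * (6 : ℕ) + (3 : ℕ)) := by push_cast; ring
        rw [this, zpow_add₀ hp0.ne', zpow_add₀ hp0.ne', zpow_mul p r, zpow_natCast, zpow_natCast]
      have c4 : p ^ (r + 1) = p ^ r * p := by rw [zpow_add₀ hp0.ne', zpow_one]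
      have hG1 : G (r + 1) = -y / (p ^ r * p) ^ 3 * (-(-1) ^ r * (p ^ (3 * r ^ 2) *
            ((p ^ r) ^ 6 * p ^ 3))) * (ww p ((n + 1 : ℕ) + 2 * r) *
            ((1 - y / (p ^ r) ^ 2 / p) *
              ((1 - y / (p ^ r) ^ 2) * ww p ((n + 1 : ℕ) - 2 * r)))) := by
        rw [hG]; simp only
        rw [← w4, ← w3, c1, c2, c4]; ring
      rw [hG1, hG]
      simp only
      rw [w1, w2]
      have hx : 0 < p ^ r := by positivity
      generalize p ^ r = x at *
      generalize ww p ((n + 1 : ℕ) + 2 * r) = W1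
      generalize ww p ((n + 1 : ℕ) - 2 * r) = W2
      generalize (-1 : ℝ) ^ r = s
      generalize p ^ (3 * r ^ 2) = t
      clear_value y
      field_simp
      ring
    · exact (hsum _ (n + 1)).mul_left _
    · exact hsum _ n
    · exact hsum _ (n + 1)

/-! The inner sum in Bailey's lemma. -/
lemma bailey_inner {q : ℝ} (hq0 : 0 < q) (hq1 : q < 1) (r : ℤ) (N : ℕ) :
    ∑ n ∈ Finset.range (N + 1), q ^ (n ^ 2) * qp (q ^ 2) (-q) n *
      (ww (q ^ 2) (N - n) * ww (q ^ 2) (n - r) * ww (q ^ 2) (n + r)) =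
    q ^ (r ^ 2) * qp (q ^ 2) (-q) N * (ww (q ^ 2) (N - r) * ww (q ^ 2) (N + r)) := by
  have hp0 : 0 < q ^ 2 := by positivity
  have hp1 : q ^ 2 < 1 := by nlinarith
  induction N with
  | zero =>
    rcases lt_trichotomy r 0 with h | h | h
    · simp [ww_neg _ h]
    · subst h; simp [ww_zero]
    · simp [ww_neg _ (show -r < 0 by omega)]
  | succ N ih =>
    set p := q ^ 2 with hp
    by_cases hr : r = (N + 1 : ℕ) ∨ r = -(N + 1 : ℕ)
    · rw [Finset.sum_range_succ, Finset.sum_eq_zero]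
      · have e : q ^ (r ^ 2) = q ^ ((N + 1) ^ 2) := by
          rw [← zpow_natCast]; congr 1
          rcases hr with h | h <;> rw [h] <;> push_cast <;> ring
        rw [e, sub_self, ww_zero]; ring
      · intro n hn
        rw [Finset.mem_range] at hn
        rcases hr with h | h
        · rw [ww_neg _ (show (n : ℤ) - r < 0 by omega)]; simp
        · rw [ww_neg _ (show (n : ℤ) + r < 0 by omega)]; simp
    · push Not at hr
      set y : ℝ := p ^ (N + 1) with hy
      have hy0 : 0 < y := by positivity
      set g : ℕ → ℝ := fun n => -y / p ^ n * (q ^ (n ^ 2) * qp p (-q) n) *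
        (ww p ((N + 1 : ℕ) - n) * ww p (n - 1 - r) * ww p (n - 1 + r)) with hg
      have hne : ∀ k : ℤ, k ≠ 0 → 1 - p ^ k ≠ 0 := by
        intro k hk h
        have h1 : p ^ k = 1 := by linarith
        rw [zpow_eq_one_iff_right₀ hp0.le hp1.ne] at h1
        exact hk h1
      have t1 : ∀ n ∈ Finset.range (N + 1 + 1),
          ((1 - y / p ^ r) * (1 - y * p ^ r)) * (q ^ (n ^ 2) * qp p (-q) n *
            (ww p ((N + 1 : ℕ) - n) * ww p (n - r) * ww p (n + r))) -
          (1 + y / q) * (q ^ (n ^ 2) * qp p (-q) n *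
            (ww p (N - n) * ww p (n - r) * ww p (n + r))) = g (n + 1) - g n := by
        intro n _
        have w1 : ww p (N - n) = (1 - y / p ^ n) * ww p ((N + 1 : ℕ) - n) := by
          have := ww_pred hp0 hp1 ((N + 1 : ℕ) - n)
          rw [zpow_sub₀ hp0.ne', zpow_natCast, zpow_natCast] at this
          rw [← this]; congr 1; push_cast; ring
        have w2 : ww p ((N + 1 : ℕ) - (n + 1 : ℕ)) = (1 - y / p ^ n) * ww p ((N + 1 : ℕ) - n) := by
          rw [← w1]; congr 1; push_cast; ring
        have w3 : ww p (n - 1 - r) = (1 - p ^ n / p ^ r) * ww p (n - r) := by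
          have := ww_pred hp0 hp1 (n - r)
          rw [zpow_sub₀ hp0.ne', zpow_natCast] at this
          rw [← this]; congr 1; ring
        have w4 : ww p (n - 1 + r) = (1 - p ^ n * p ^ r) * ww p (n + r) := by
          have := ww_pred hp0 hp1 (n + r)
          rw [zpow_add₀ hp0.ne', zpow_natCast] at this
          rw [← this]; congr 1; ring
        have w5 : ww p ((n + 1 : ℕ) - 1 - r) = ww p (n - r) := by
          congr 1; push_cast; ring
        have w6 : ww p ((n + 1 : ℕ) - 1 + r) = ww p (n + r) := by
          congr 1; push_cast; ring
        have c1 : q ^ ((n + 1) ^ 2) = q ^ (n ^ 2) * (p ^ n * q) := by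
          rw [hp]; ring
        rw [hg]
        simp only
        rw [w2, w5, w6, w1, w3, w4, c1, qp_succ, pow_succ p n]
        have hx : 0 < p ^ r := by positivity
        have hx' : 0 < p ^ n := by positivity
        generalize p ^ r = x at *
        generalize p ^ n = z at *
        generalize ww p ((N + 1 : ℕ) - n) = W1
        generalize ww p (n - r) = W2
        generalize ww p (n + r) = W3
        generalize qp p (-q) n = s
        generalize q ^ (n ^ 2) = t
        rw [hp]
        clear_value y
        field_simp
        ring
      have t2 := Finset.sum_congr rfl t1
      rw [Finset.sum_range_sub, Finset.sum_sub_distrib, ← Finset.mul_sum, ← Finset.mul_sum] at t2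
      have g0 : g 0 = 0 := by
        rw [hg]; simp only
        rcases lt_or_ge r 0 with h | h
        · rw [ww_neg _ (show ((0 : ℕ) : ℤ) - 1 + r < 0 by omega)]; simp
        · rw [ww_neg _ (show ((0 : ℕ) : ℤ) - 1 - r < 0 by omega)]; simp
      have g1 : g (N + 1 + 1) = 0 := by
        rw [hg]; simp only
        rw [ww_neg _ (show ((N + 1 : ℕ) : ℤ) - (N + 1 + 1 : ℕ) < 0 by push_cast; omega)]; simp
      rw [g0, g1, Finset.sum_range_succ _ (N + 1), Finset.sum_range_succ _ (N + 1), ih,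
        ww_neg _ (show (N : ℤ) - (N + 1 : ℕ) < 0 by push_cast; omega)] at t2
      rw [← Finset.sum_range_succ (fun n : ℕ => q ^ (n ^ 2) * qp p (-q) n *
            (ww p ((N + 1 : ℕ) - n) * ww p (n - r) * ww p (n + r))) (N + 1)] at t2
      have v1 : ww p (N - r) = (1 - y / p ^ r) * ww p ((N + 1 : ℕ) - r) := by
        have := ww_pred hp0 hp1 ((N + 1 : ℕ) - r)
        rw [zpow_sub₀ hp0.ne', zpow_natCast] at this
        rw [← this]; congr 1; push_cast; ring
      have v2 : ww p (N + r) = (1 - y * p ^ r) * ww p ((N + 1 : ℕ) + r) := by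
        have := ww_pred hp0 hp1 ((N + 1 : ℕ) + r)
        rw [zpow_add₀ hp0.ne', zpow_natCast] at this
        rw [← this]; congr 1; push_cast; ring
      have n1 : (1 - y / p ^ r) ≠ 0 := by
        have := hne ((N + 1 : ℕ) - r) (by omega)
        rwa [zpow_sub₀ hp0.ne', zpow_natCast] at this
      have n2 : (1 - y * p ^ r) ≠ 0 := by
        have := hne ((N + 1 : ℕ) + r) (by omega)
        rwa [zpow_add₀ hp0.ne', zpow_natCast] at this
      have n3 : 1 + y / q = 1 - -q * p ^ N := by
        rw [hy, pow_succ, hp]; field_simp; ring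
      apply mul_left_cancel₀ (mul_ne_zero n1 n2)
      rw [qp_succ, ← n3]
      rw [v1, v2] at t2
      linear_combination t2

open Filter Topology in
lemma qp_tendsto {p : ℝ} (hp0 : 0 < p) (hp1 : p < 1) (a : ℝ) :
    Tendsto (qp p a) atTop (𝓝 (qpi p a)) := by
  have hs : Summable fun k : ℕ => ‖-(a * p ^ k)‖ := by
    have := ((summable_geometric_of_lt_one hp0.le hp1).mul_left a).norm
    simpa using this
  have hm := multipliable_one_add_of_summable hs
  have := hm.tendsto_prod_tprod_nat
  have e : qp p a = fun n => ∏ i ∈ Finset.range n, (1 + -(a * p ^ i)) := by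
    funext n; simp [qp, sub_eq_add_neg]
  rw [e]
  simpa [qpi, sub_eq_add_neg] using this

lemma qpi_ne_zero {p a : ℝ} (hp0 : 0 < p) (hp1 : p < 1) (ha : a < 1) : qpi p a ≠ 0 := by
  have hs : Summable fun k : ℕ => ‖-(a * p ^ k)‖ := by
    have := ((summable_geometric_of_lt_one hp0.le hp1).mul_left a).norm
    simpa using this
  have := tprod_one_add_ne_zero_of_summable (f := fun k : ℕ => -(a * p ^ k)) (fun k => by
    have := one_sub_pos_aux hp0 hp1 ha k
    rw [← sub_eq_add_neg]; exact this.ne') hs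
  simpa [qpi, sub_eq_add_neg] using this

open Filter Topology in
lemma ww_tendsto {p : ℝ} (hp0 : 0 < p) (hp1 : p < 1) (c : ℤ) :
    Tendsto (fun N : ℕ => ww p (N + c)) atTop (𝓝 (1 / qpi p p)) := by
  have h1 : Tendsto (fun n : ℕ => 1 / qp p p n) atTop (𝓝 (1 / qpi p p)) :=
    tendsto_const_nhds.div (qp_tendsto hp0 hp1 p) (qpi_ne_zero hp0 hp1 hp1)
  have h2 : Tendsto (fun N : ℕ => ((N : ℤ) + c).toNat) atTop atTop := by
    rw [tendsto_atTop]
    intro b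
    filter_upwards [eventually_ge_atTop (b + c.natAbs)] with N hN
    omega
  refine (h1.comp h2).congr' ?_
  filter_upwards [eventually_ge_atTop c.natAbs] with N hN
  have : ¬ ((N : ℤ) + c < 0) := by omega
  simp [ww, this]

lemma ww_bound {p : ℝ} (hp0 : 0 < p) (hp1 : p < 1) : ∃ C : ℝ, 0 ≤ C ∧ ∀ k, |ww p k| ≤ C := by
  have h1 := ww_tendsto hp0 hp1 0
  obtain ⟨C, hC⟩ := h1.norm.bddAbove_range
  have hC' : ∀ N : ℕ, |ww p N| ≤ C := by
    intro N
    have := hC (Set.mem_range_self N)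
    simpa using this
  have hC0 : 0 ≤ C := (abs_nonneg _).trans (hC' 0)
  refine ⟨C, hC0, fun k => ?_⟩
  rcases lt_or_ge k 0 with h | h
  · rw [ww_neg _ h]; simpa using hC0
  · lift k to ℕ using h
    exact hC' k

open Filter Topology in
lemma tannery {β : Type*} {c : β → ℝ} (hc : Summable c) {f : ℕ → β → ℝ} {C L : ℝ}
    (hf : ∀ N b, |f N b| ≤ C) (hL : ∀ b, Tendsto (fun N => f N b) atTop (𝓝 L)) :
    Tendsto (fun N => ∑' b, c b * f N b) atTop (𝓝 ((∑' b, c b) * L)) := by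
  rw [← tsum_mul_right]
  apply tendsto_tsum_of_dominated_convergence (bound := fun b => |c b| * C)
  · exact hc.abs.mul_right C
  · intro b; exact (hL b).const_mul _
  · filter_upwards with N b
    rw [Real.norm_eq_abs, abs_mul]
    exact mul_le_mul_of_nonneg_left (hf N b) (abs_nonneg _)

open Filter Topology in
lemma tannery_ww {p : ℝ} (hp0 : 0 < p) (hp1 : p < 1) {c : ℤ → ℝ} (hc : Summable c) (e : ℤ → ℤ) :
    Tendsto (fun N : ℕ => ∑' j, c j * (ww p (N + e j) * ww p (N - e j))) atTop
      (𝓝 ((∑' j, c j) * (1 / qpi p p * (1 / qpi p p)))) := by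
  obtain ⟨C, hC0, hC⟩ := ww_bound hp0 hp1
  apply tannery hc (C := C * C)
  · intro N j
    rw [abs_mul]
    exact mul_le_mul (hC _) (hC _) (abs_nonneg _) hC0
  · intro j
    have h2 := ww_tendsto hp0 hp1 (-(e j))
    simp only [← sub_eq_add_neg] at h2
    exact (ww_tendsto hp0 hp1 (e j)).mul h2

noncomputable def th (q : ℝ) (j : ℤ) : ℝ := (-1) ^ j * (q ^ 10) ^ (j ^ 2) * (q ^ 2) ^ j

lemma neg_one_zpow_abs (j : ℤ) : |(-1 : ℝ) ^ j| = 1 := by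
  rw [abs_zpow]; simp

lemma th_summable {q : ℝ} (hq0 : 0 < q) (hq1 : q < 1) : Summable (th q) := by
  have h1 : Summable fun j : ℤ => q ^ j.natAbs := by
    apply Summable.of_nat_of_neg
    · simpa using summable_geometric_of_lt_one hq0.le hq1
    · simpa using summable_geometric_of_lt_one hq0.le hq1
  refine Summable.of_norm_bounded h1 fun j => ?_
  rw [th, Real.norm_eq_abs, abs_mul, abs_mul, neg_one_zpow_abs, one_mul,
    abs_of_pos (by positivity), abs_of_pos (by positivity)]
  have e : (q ^ 10) ^ (j ^ 2) * (q ^ 2) ^ j = q ^ (10 * j ^ 2 + 2 * j) := by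
    rw [zpow_add₀ hq0.ne', zpow_mul, zpow_mul]; norm_cast
  rw [e, ← zpow_natCast]
  apply zpow_le_zpow_right_of_le_one₀ hq0 hq1.le
  have h2 : ((j.natAbs : ℤ)) ^ 2 = j ^ 2 := Int.natAbs_sq j
  have h3 : -(j.natAbs : ℤ) ≤ j := by omega
  have h4 : (j.natAbs : ℤ) ≤ (j.natAbs : ℤ) ^ 2 := by
    have : j.natAbs ≤ j.natAbs ^ 2 := Nat.le_self_pow (by norm_num) _
    exact_mod_cast this
  nlinarith

open Filter Topology in
lemma theta_prod {q : ℝ} (hq0 : 0 < q) (hq1 : q < 1) :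
    ∑' j, th q j = qpi (q ^ 20) (q ^ 8) * qpi (q ^ 20) (q ^ 12) * qpi (q ^ 20) (q ^ 20) := by
  have hu0 : 0 < q ^ 10 := by positivity
  have hu1 : q ^ 10 < 1 := pow_lt_one₀ hq0.le hq1 (by norm_num)
  have hR0 : 0 < q ^ 20 := by positivity
  have hR1 : q ^ 20 < 1 := pow_lt_one₀ hq0.le hq1 (by norm_num)
  have h1 := tannery_ww hR0 hR1 (th_summable hq0 hq1) (fun j => j)
  have hfin : ∀ m : ℕ, ∑' j, th q j * (ww (q ^ 20) (m + j) * ww (q ^ 20) (m - j)) =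
      qp (q ^ 20) (q ^ 12) m * qp (q ^ 20) (q ^ 8) m / qp (q ^ 20) (q ^ 20) (2 * m) := by
    intro m
    have := jtp_fin hu0 hu1 (pow_ne_zero 2 hq0.ne') m
    have e1 : (q ^ 10) ^ 2 = q ^ 20 := by ring
    have e2 : q ^ 10 * q ^ 2 = q ^ 12 := by ring
    have e3 : q ^ 10 / q ^ 2 = q ^ 8 := by field_simp
    rw [e1, e2, e3] at this
    exact this
  simp only [hfin] at h1
  have hne := qpi_ne_zero hR0 hR1 hR1
  have h2 : Tendsto (fun m : ℕ => 2 * m) atTop atTop :=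
    tendsto_id.const_mul_atTop' (by norm_num)
  have h3 := ((qp_tendsto hR0 hR1 (q ^ 12)).mul (qp_tendsto hR0 hR1 (q ^ 8))).div
    ((qp_tendsto hR0 hR1 (q ^ 20)).comp h2) hne
  have h4 := tendsto_nhds_unique h1 h3
  field_simp at h4
  linear_combination h4

lemma qp_two (p a : ℝ) (n : ℕ) : qp p a (2 * n) = qp (p ^ 2) a n * qp (p ^ 2) (a * p) n := by
  induction n with
  | zero => simp [qp_zero]
  | succ n ih =>
    rw [show 2 * (n + 1) = 2 * n + 1 + 1 by ring]
    simp only [qp_succ]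
    rw [ih]; ring

lemma qp_five (p a : ℝ) (n : ℕ) : qp p a (5 * n) = qp (p ^ 5) a n * qp (p ^ 5) (a * p) n *
    qp (p ^ 5) (a * p ^ 2) n * qp (p ^ 5) (a * p ^ 3) n * qp (p ^ 5) (a * p ^ 4) n := by
  induction n with
  | zero => simp [qp_zero]
  | succ n ih =>
    rw [show 5 * (n + 1) = 5 * n + 1 + 1 + 1 + 1 + 1 by ring]
    simp only [qp_succ]
    rw [ih]
    have e : p ^ (5 * n) = (p ^ 5) ^ n := by rw [pow_mul]
    simp only [pow_succ p (5 * n), pow_succ p (5 * n + 1), pow_succ p (5 * n + 2),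
      pow_succ p (5 * n + 3), pow_succ p (5 * n + 4), pow_add p, e]
    generalize (p ^ 5) ^ n = z
    ring

lemma qp_sq (p a : ℝ) (n : ℕ) : qp (p ^ 2) (a ^ 2) n = qp p a n * qp p (-a) n := by
  induction n with
  | zero => simp [qp_zero]
  | succ n ih =>
    simp only [qp_succ]
    rw [ih]; ring

open Filter Topology in
lemma qpi_two {p : ℝ} (hp0 : 0 < p) (hp1 : p < 1) (a : ℝ) :
    qpi p a = qpi (p ^ 2) a * qpi (p ^ 2) (a * p) := by
  have h0 : 0 < p ^ 2 := by positivity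
  have h1 : p ^ 2 < 1 := pow_lt_one₀ hp0.le hp1 (by norm_num)
  have h2 : Tendsto (fun m : ℕ => 2 * m) atTop atTop :=
    tendsto_id.const_mul_atTop' (by norm_num)
  have h3 := (qp_tendsto hp0 hp1 a).comp h2
  refine tendsto_nhds_unique h3 ?_
  refine ((qp_tendsto h0 h1 a).mul (qp_tendsto h0 h1 (a * p))).congr fun n => ?_
  exact (qp_two p a n).symm

open Filter Topology in
lemma qpi_five {p : ℝ} (hp0 : 0 < p) (hp1 : p < 1) (a : ℝ) :
    qpi p a = qpi (p ^ 5) a * qpi (p ^ 5) (a * p) * qpi (p ^ 5) (a * p ^ 2) *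
      qpi (p ^ 5) (a * p ^ 3) * qpi (p ^ 5) (a * p ^ 4) := by
  have h0 : 0 < p ^ 5 := by positivity
  have h1 : p ^ 5 < 1 := pow_lt_one₀ hp0.le hp1 (by norm_num)
  have h2 : Tendsto (fun m : ℕ => 5 * m) atTop atTop :=
    tendsto_id.const_mul_atTop' (by norm_num)
  have h3 := (qp_tendsto hp0 hp1 a).comp h2
  refine tendsto_nhds_unique h3 ?_
  refine (((((qp_tendsto h0 h1 a).mul (qp_tendsto h0 h1 (a * p))).mul
    (qp_tendsto h0 h1 (a * p ^ 2))).mul (qp_tendsto h0 h1 (a * p ^ 3))).mul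
    (qp_tendsto h0 h1 (a * p ^ 4))).congr fun n => ?_
  exact (qp_five p a n).symm

lemma qpi_sq {p : ℝ} (hp0 : 0 < p) (hp1 : p < 1) (a : ℝ) :
    qpi (p ^ 2) (a ^ 2) = qpi p a * qpi p (-a) := by
  have h0 : 0 < p ^ 2 := by positivity
  have h1 : p ^ 2 < 1 := pow_lt_one₀ hp0.le hp1 (by norm_num)
  refine tendsto_nhds_unique (qp_tendsto h0 h1 (a ^ 2)) ?_
  refine ((qp_tendsto hp0 hp1 a).mul (qp_tendsto hp0 hp1 (-a))).congr fun n => ?_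
  exact (qp_sq p a n).symm

lemma main_fin {q : ℝ} (hq0 : 0 < q) (hq1 : q < 1) (N : ℕ) :
    ∑ n ∈ Finset.range (N + 1), q ^ (n ^ 2) / qp q q (2 * n) * ww (q ^ 2) (N - n) =
      qp (q ^ 2) (-q) N / 2 *
        ∑' r : ℤ, (th q r + th q (-r)) * (ww (q ^ 2) (N + 2 * r) * ww (q ^ 2) (N - 2 * r)) := by
  have hp0 : 0 < q ^ 2 := by positivity
  have hp1 : q ^ 2 < 1 := pow_lt_one₀ hq0.le hq1 (by norm_num)
  have hp20 : 0 < (q ^ 2) ^ 2 := by positivity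
  have hp21 : (q ^ 2) ^ 2 < 1 := pow_lt_one₀ hp0.le hp1 (by norm_num)
  have hterm : ∀ n ∈ Finset.range (N + 1),
      q ^ (n ^ 2) / qp q q (2 * n) * ww (q ^ 2) (N - n) =
      ∑' r : ℤ, (1 / 2 * ((-1) ^ r * (q ^ 2) ^ (3 * r ^ 2) * ((q ^ 2) ^ r + 1 / (q ^ 2) ^ r))) *
        (q ^ (n ^ 2) * qp (q ^ 2) (-q) n * (ww (q ^ 2) (N - n) * ww (q ^ 2) (n - 2 * r) *
          ww (q ^ 2) (n + 2 * r))) := by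
    intro n _
    have hb := bailey_c1 hp0 hp1 n
    have : ∀ r : ℤ, (1 / 2 * ((-1) ^ r * (q ^ 2) ^ (3 * r ^ 2) *
        ((q ^ 2) ^ r + 1 / (q ^ 2) ^ r))) *
        (q ^ (n ^ 2) * qp (q ^ 2) (-q) n * (ww (q ^ 2) (N - n) * ww (q ^ 2) (n - 2 * r) *
          ww (q ^ 2) (n + 2 * r))) = (1 / 2 * q ^ (n ^ 2) * qp (q ^ 2) (-q) n * ww (q ^ 2) (N - n)) *
          ((-1) ^ r * (q ^ 2) ^ (3 * r ^ 2) * ((q ^ 2) ^ r + 1 / (q ^ 2) ^ r) *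
            (ww (q ^ 2) (n - 2 * r) * ww (q ^ 2) (n + 2 * r))) := fun r => by ring
    rw [tsum_congr this, tsum_mul_left, hb, qp_two q q, qp_sq (q ^ 2) q n]
    have e : q * q = q ^ 2 := by ring
    rw [e]
    have n1 := (qp_pos hp0 hp1 hp1 n).ne'
    have n2 := (qp_pos hp0 hp1 hq1 n).ne'
    have n3 := (qp_pos hp0 hp1 (show -q < 1 by linarith) n).ne'
    field_simp
  rw [Finset.sum_congr rfl hterm, ← Summable.tsum_finsetSum]
  · rw [← tsum_mul_left]
    apply tsum_congr
    intro r
    rw [← Finset.mul_sum, bailey_inner hq0 hq1 (2 * r) N]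
    have e1 : (-1 : ℝ) ^ (-r) = (-1) ^ r := by rw [zpow_neg, ← inv_zpow]; norm_num
    have e2 : (q ^ 10) ^ (r ^ 2) = (q ^ 2) ^ (3 * r ^ 2) * q ^ ((2 * r) ^ 2) := by
      have a1 : q ^ 10 = q ^ (10 : ℤ) := by norm_cast
      have a2 : q ^ 2 = q ^ (2 : ℤ) := by norm_cast
      rw [a1, a2, ← zpow_mul, ← zpow_mul, ← zpow_add₀ hq0.ne']
      congr 1; ring
    rw [th, th, e1, neg_sq, e2, zpow_neg]
    ring
  · intro n _
    apply summable_box n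
    rintro j (hj | hj)
    · rw [ww_neg _ (show (n : ℤ) - 2 * j < 0 by omega)]; simp
    · rw [ww_neg _ (show (n : ℤ) + 2 * j < 0 by omega)]; simp

open Filter Topology in
theorem slater79 (q : ℝ) (hq0 : 0 < q) (hq1 : q < 1) :
    ∑' n : ℕ, q ^ (n ^ 2) / qp q q (2 * n) =
      1 / (qpi (q ^ 2) q * qpi (q ^ 20) (q ^ 4) * qpi (q ^ 20) (q ^ 16)) := by
  have hlt : ∀ k : ℕ, k ≠ 0 → q ^ k < 1 := fun k hk => pow_lt_one₀ hq0.le hq1 hk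
  have hpos : ∀ k : ℕ, 0 < q ^ k := fun k => by positivity
  have hp0 := hpos 2
  have hp1 := hlt 2 (by norm_num)
  obtain ⟨C, hC0, hC⟩ := ww_bound hq0 hq1
  obtain ⟨C', hC0', hC'⟩ := ww_bound hp0 hp1
  have hsum : Summable fun n : ℕ => q ^ (n ^ 2) / qp q q (2 * n) := by
    refine Summable.of_norm_bounded ((summable_geometric_of_lt_one hq0.le hq1).mul_right C)
      fun n => ?_
    have h1 := hC ((2 * n : ℕ) : ℤ)
    rw [ww_nat] at h1
    rw [div_eq_mul_one_div, Real.norm_eq_abs, abs_mul, abs_of_pos (hpos _)]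
    have h2 : q ^ (n ^ 2) ≤ q ^ n :=
      pow_le_pow_of_le_one hq0.le hq1.le (Nat.le_self_pow (by norm_num) _)
    exact mul_le_mul h2 h1 (abs_nonneg _) (hpos _).le
  have hL : Tendsto (fun N : ℕ => ∑' n : ℕ, q ^ (n ^ 2) / qp q q (2 * n) * ww (q ^ 2) (N - n))
      atTop (𝓝 ((∑' n : ℕ, q ^ (n ^ 2) / qp q q (2 * n)) * (1 / qpi (q ^ 2) (q ^ 2)))) := by
    apply tannery hsum (f := fun N n => ww (q ^ 2) (N - n)) (C := C')
    · intro N b; exact hC' _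
    · intro b
      have := ww_tendsto hp0 hp1 (-(b : ℤ))
      simpa only [← sub_eq_add_neg] using this
  have hfin : ∀ N : ℕ, ∑' n : ℕ, q ^ (n ^ 2) / qp q q (2 * n) * ww (q ^ 2) (N - n) =
      qp (q ^ 2) (-q) N / 2 *
        ∑' r : ℤ, (th q r + th q (-r)) *
          (ww (q ^ 2) (N + 2 * r) * ww (q ^ 2) (N - 2 * r)) := by
    intro N
    rw [← main_fin hq0 hq1 N]
    apply tsum_eq_sum
    intro n hn
    rw [Finset.mem_range] at hn
    rw [ww_neg _ (show (N : ℤ) - n < 0 by omega)]; simp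
  simp only [hfin] at hL
  have hth := th_summable hq0 hq1
  have hth' : Summable fun r => th q (-r) := (Equiv.neg ℤ).summable_iff.mpr hth
  have hthe : ∑' r, th q (-r) = ∑' r, th q r := (Equiv.neg ℤ).tsum_eq (th q)
  have hR := ((qp_tendsto hp0 hp1 (-q)).div_const 2).mul
    (tannery_ww hp0 hp1 (hth.add hth') (fun r => 2 * r))
  have key := tendsto_nhds_unique hL hR
  rw [hth.tsum_add hth', hthe, theta_prod hq0 hq1] at key
  have p1 := qpi_two hp0 hp1 (q ^ 2)
  have p2 := qpi_sq hp0 hp1 q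
  have p3 := qpi_five (hpos 4) (hlt 4 (by norm_num)) (q ^ 4)
  simp only [← pow_mul, ← pow_add] at p1 p2 p3
  norm_num at p1 p2 p3
  have hm : -q < 1 := by linarith
  have n0 := qpi_ne_zero hp0 hp1 hp1
  have n1 := qpi_ne_zero hp0 hp1 hq1
  have n2 := qpi_ne_zero hp0 hp1 hm
  have n3 := qpi_ne_zero (hpos 20) (hlt 20 (by norm_num)) (hlt 4 (by norm_num))
  have n4 := qpi_ne_zero (hpos 20) (hlt 20 (by norm_num)) (hlt 8 (by norm_num))
  have n5 := qpi_ne_zero (hpos 20) (hlt 20 (by norm_num)) (hlt 12 (by norm_num))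
  have n6 := qpi_ne_zero (hpos 20) (hlt 20 (by norm_num)) (hlt 16 (by norm_num))
  have n7 := qpi_ne_zero (hpos 20) (hlt 20 (by norm_num)) (hlt 20 (by norm_num))
  rw [p2, p3] at p1
  generalize ∑' n : ℕ, q ^ (n ^ 2) / qp q q (2 * n) = S at *
  rw [p1] at key
  field_simp at key
  field_simp
  linear_combination key / 2
end

section
/- For 0 < q < 1, 1/((q;q⁵)_∞(q⁴;q⁵)_∞) = (-q²;q²)_∞ ∑_{n=0}^∞ q^{n²} / ((q²;q²)_n (-q²;q²)_n). -/
noncomputable def PP (q : ℝ) (n : ℕ) : ℝ := qp q q n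

lemma PP_zero (q : ℝ) : PP q 0 = 1 := by simp [PP, qp]

lemma PP_succ (q : ℝ) (n : ℕ) : PP q (n+1) = PP q n * (1 - q^(n+1)) := by
  simp only [PP, qp, Finset.prod_range_succ]; ring

lemma PP_pos {q : ℝ} (h0 : 0 < q) (h1 : q < 1) (n : ℕ) : 0 < PP q n := by
  induction n with
  | zero => simp [PP_zero]
  | succ n ih =>
    rw [PP_succ]
    have : q^(n+1) < 1 := pow_lt_one₀ h0.le h1 (by omega)
    exact mul_pos ih (by linarith)

lemma conv_split {q : ℝ} (h0 : 0 < q) (h1 : q < 1) (f : ℕ → ℝ) (n : ℕ) :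
    (1 - q^(n+1)) * ∑ k ∈ Finset.range (n+2), f k / (PP q k * PP q (n+1-k)) =
      ∑ k ∈ Finset.range (n+1), f k / (PP q k * PP q (n-k)) +
      ∑ k ∈ Finset.range (n+1), q^(n-k) * f (k+1) / (PP q k * PP q (n-k)) := by
  have hP := fun n => (PP_pos h0 h1 n).ne'
  have hq : ∀ n : ℕ, (1 - q^(n+1)) ≠ 0 := fun n => by
    have : q^(n+1) < 1 := pow_lt_one₀ h0.le h1 (by omega)
    linarith
  have e1 : (1 - q^(n+1)) * ∑ k ∈ Finset.range (n+2), f k / (PP q k * PP q (n+1-k)) =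
      ∑ k ∈ Finset.range (n+2), f k * (1 - q^(n+1-k)) / (PP q k * PP q (n+1-k)) +
      ∑ k ∈ Finset.range (n+2), f k * q^(n+1-k) * (1 - q^k) / (PP q k * PP q (n+1-k)) := by
    rw [Finset.mul_sum, ← Finset.sum_add_distrib]
    refine Finset.sum_congr rfl fun k hk => ?_
    have hk : k ≤ n+1 := by simpa [Nat.lt_succ_iff] using hk
    have : q^(n+1) = q^(n+1-k) * q^k := by rw [← pow_add]; congr 1; omega
    rw [this]; ring
  rw [e1, Finset.sum_range_succ, Finset.sum_range_succ' _ (n+1)]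
  simp only [Nat.sub_self, pow_zero, sub_self, mul_zero, zero_div, add_zero]
  congr 1
  · refine Finset.sum_congr rfl fun k hk => ?_
    have hk : k ≤ n := by simpa [Nat.lt_succ_iff] using hk
    have : n + 1 - k = (n - k) + 1 := by omega
    rw [this, PP_succ]
    have := hP k; have := hP (n-k); have := hq (n-k)
    field_simp
  · refine Finset.sum_congr rfl fun k hk => ?_
    have : n + 1 - (k+1) = (n - k) := by omega
    rw [this, PP_succ]
    have := hP k; have := hP (n-k); have := hq k
    field_simp

lemma one_sub_pow_ne {q : ℝ} (h0 : 0 < q) (h1 : q < 1) (n : ℕ) : (1 - q^(n+1)) ≠ 0 := by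
  have : q^(n+1) < 1 := pow_lt_one₀ h0.le h1 (by omega)
  linarith

lemma vandermonde {q : ℝ} (h0 : 0 < q) (h1 : q < 1) (n : ℕ) : ∀ M : ℕ,
    ∑ k ∈ Finset.range (n+1), (q^(k^2+M*k) / PP q (k+M)) / (PP q k * PP q (n-k)) =
      1 / (PP q n * PP q (n+M)) := by
  induction n with
  | zero => intro M; simp [PP_zero]
  | succ n ih =>
    intro M
    have hP := fun n => (PP_pos h0 h1 n).ne'
    have h := conv_split h0 h1 (fun k => q^(k^2+M*k) / PP q (k+M)) n
    have e2 : ∑ k ∈ Finset.range (n+1), q^(n-k) * (q^((k+1)^2+M*(k+1)) / PP q (k+1+M)) / (PP q k * PP q (n-k))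
        = q^(n+1+M) * ∑ k ∈ Finset.range (n+1), (q^(k^2+(M+1)*k) / PP q (k+(M+1))) / (PP q k * PP q (n-k)) := by
      rw [Finset.mul_sum]
      refine Finset.sum_congr rfl fun k hk => ?_
      have hk : k ≤ n := by simpa [Nat.lt_succ_iff] using hk
      obtain ⟨d, rfl⟩ := Nat.exists_eq_add_of_le hk
      have : k + d - k = d := by omega
      rw [this, show k + 1 + M = k + (M+1) by ring]
      ring
    rw [e2, ih, ih] at h
    apply mul_left_cancel₀ (one_sub_pow_ne h0 h1 n)
    rw [h, PP_succ, show n + (M+1) = (n+M)+1 by ring, show n + 1 + M = (n+M)+1 by ring, PP_succ]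
    have := hP n; have := hP (n+M); have := one_sub_pow_ne h0 h1 n
    have := one_sub_pow_ne h0 h1 (n+M)
    field_simp
    ring

lemma sq_ne {q : ℝ} (h0 : 0 < q) (h1 : q < 1) : 0 < q^2 ∧ q^2 < 1 :=
  ⟨by positivity, pow_lt_one₀ h0.le h1 (by omega)⟩

lemma rs_sum {q : ℝ} (h0 : 0 < q) (h1 : q < 1) (n : ℕ) :
    ∑ k ∈ Finset.range (n+1), q^k / (PP (q^2) k * PP (q^2) (n-k)) = 1 / PP q n := by
  obtain ⟨a0, a1⟩ := sq_ne h0 h1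
  induction n with
  | zero => simp [PP_zero]
  | succ n ih =>
    have h := conv_split a0 a1 (fun k => q^k) n
    have e2 : ∑ k ∈ Finset.range (n+1), (q^2)^(n-k) * q^(k+1) / (PP (q^2) k * PP (q^2) (n-k))
        = q^(n+1) * ∑ k ∈ Finset.range (n+1), q^k / (PP (q^2) k * PP (q^2) (n-k)) := by
      rw [← Finset.sum_range_reflect, Finset.mul_sum]
      refine Finset.sum_congr rfl fun k hk => ?_
      have hk : k ≤ n := by simpa [Nat.lt_succ_iff] using hk
      obtain ⟨d, rfl⟩ := Nat.exists_eq_add_of_le hk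
      have t1 : k + d + 1 - 1 - k = d := by omega
      have t2 : k + d - d = k := by omega
      have t3 : k + d - k = d := by omega
      rw [t1, t2, t3]
      ring
    rw [e2, ih] at h
    apply mul_left_cancel₀ (one_sub_pow_ne a0 a1 n)
    rw [h, PP_succ]
    have := (PP_pos h0 h1 n).ne'; have := one_sub_pow_ne h0 h1 n
    field_simp
    ring

lemma qbinom {q : ℝ} (h0 : 0 < q) (h1 : q < 1) (z : ℝ) (n : ℕ) :
    ∑ k ∈ Finset.range (n+1), ((-z)^k * q^(k.choose 2)) / (PP q k * PP q (n-k)) =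
      qp q z n / PP q n := by
  induction n with
  | zero => simp [PP_zero, qp]
  | succ n ih =>
    have h := conv_split h0 h1 (fun k => (-z)^k * q^(k.choose 2)) n
    have e2 : ∑ k ∈ Finset.range (n+1), q^(n-k) * ((-z)^(k+1) * q^((k+1).choose 2)) / (PP q k * PP q (n-k))
        = (-z * q^n) * ∑ k ∈ Finset.range (n+1), ((-z)^k * q^(k.choose 2)) / (PP q k * PP q (n-k)) := by
      rw [Finset.mul_sum]
      refine Finset.sum_congr rfl fun k hk => ?_
      have hk : k ≤ n := by simpa [Nat.lt_succ_iff] using hk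
      obtain ⟨d, rfl⟩ := Nat.exists_eq_add_of_le hk
      have t3 : k + d - k = d := by omega
      rw [t3, Nat.choose_succ_succ' k 1, Nat.choose_one_right]
      ring
    rw [e2, ih] at h
    apply mul_left_cancel₀ (one_sub_pow_ne h0 h1 n)
    rw [h, PP_succ, show qp q z (n+1) = qp q z n * (1 - z * q^n) by simp [qp, Finset.prod_range_succ]]
    have := (PP_pos h0 h1 n).ne'; have := one_sub_pow_ne h0 h1 n
    field_simp
    ring

noncomputable def cc (q : ℝ) (N : ℕ) (m : ℤ) : ℝ :=
  if m.natAbs ≤ N then 1 / (PP q (N - m.natAbs) * PP q (N + m.natAbs)) else 0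

lemma cc_bailey {q : ℝ} (h0 : 0 < q) (h1 : q < 1) (N : ℕ) (m : ℤ) :
    ∑ s ∈ Finset.range (N+1), q^(s^2) / PP q (N-s) * cc q s m = q^(m.natAbs^2) * cc q N m := by
  set a := m.natAbs with ha
  by_cases h : a ≤ N
  · obtain ⟨n, rfl⟩ := Nat.exists_eq_add_of_le h
    rw [show a + n + 1 = a + (n+1) by ring, Finset.sum_range_add]
    rw [Finset.sum_eq_zero, zero_add]
    · have := vandermonde h0 h1 n (2*a)
      simp only [cc, ← ha]
      rw [if_pos h, show a + n - a = n by omega, show a + n + a = n + 2 * a by ring, ← this, Finset.mul_sum]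
      refine Finset.sum_congr rfl fun k hk => ?_
      have hk : k ≤ n := by simpa [Nat.lt_succ_iff] using hk
      rw [if_pos (by omega), show a + n - (a+k) = n - k by omega, show a + k - a = k by omega,
        show a + k + a = k + 2 * a by ring]
      have := (PP_pos h0 h1 k).ne'
      have := (PP_pos h0 h1 (n-k)).ne'
      have := (PP_pos h0 h1 (k+2*a)).ne'
      field_simp
      ring
    · intro s hs
      have : s < a := by simpa using hs
      simp only [cc, ← ha]
      rw [if_neg (by omega), mul_zero]
  · simp only [cc, ← ha]
    rw [if_neg h, mul_zero]
    refine Finset.sum_eq_zero fun s hs => ?_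
    have : s ≤ N := by simpa [Nat.lt_succ_iff] using hs
    rw [if_neg (by omega), mul_zero]

noncomputable def beta (q : ℝ) (α : ℤ → ℝ) (N : ℕ) : ℝ :=
  ∑ m ∈ Finset.Icc (-(N:ℤ)) N, α m * cc q N m

lemma bailey {q : ℝ} (h0 : 0 < q) (h1 : q < 1) (α : ℤ → ℝ) (N : ℕ) :
    beta q (fun m => q^(m.natAbs^2) * α m) N =
      ∑ s ∈ Finset.range (N+1), q^(s^2) / PP q (N-s) * beta q α s := by
  have : ∀ s ∈ Finset.range (N+1), q^(s^2) / PP q (N-s) * beta q α s =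
      ∑ m ∈ Finset.Icc (-(N:ℤ)) N, q^(s^2) / PP q (N-s) * (α m * cc q s m) := by
    intro s hs
    have hs : s ≤ N := by simpa [Nat.lt_succ_iff] using hs
    rw [beta, ← Finset.mul_sum]
    congr 1
    apply Finset.sum_subset
    · apply Finset.Icc_subset_Icc <;> omega
    · intro m _ hm
      simp only [Finset.mem_Icc] at hm
      rw [cc, if_neg (by omega), mul_zero]
  rw [Finset.sum_congr rfl this, Finset.sum_comm, beta]
  refine Finset.sum_congr rfl fun m _ => ?_
  have := cc_bailey h0 h1 N m
  calc _ = α m * (q^(m.natAbs^2) * cc q N m) := by ring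
    _ = _ := by
      rw [← this, Finset.mul_sum]
      exact Finset.sum_congr rfl fun s _ => by ring

def tri (m : ℤ) : ℤ := m * (m - 1) / 2

lemma two_tri (m : ℤ) : 2 * tri m = m * (m-1) :=
  Int.mul_ediv_cancel' (Int.even_mul_pred_self m).two_dvd

lemma choose_tri (n : ℕ) : ((n.choose 2 : ℕ) : ℤ) = tri n := by
  induction n with
  | zero => simp [tri]
  | succ n ih =>
    rw [Nat.choose_succ_succ' n 1, Nat.choose_one_right]
    have h1 := two_tri n
    have h2 := two_tri ((n+1 : ℕ) : ℤ)
    push_cast at *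
    rw [ih]
    linarith

lemma prod_shift {q x : ℝ} (h0 : 0 < q) (hx : 0 < x) (N : ℕ) :
    qp q (x / q^N) (2*N) = (-x)^N * q^(-(tri (N+1))) * (qp q x N * qp q (q/x) N) := by
  induction N with
  | zero => simp [qp, tri]
  | succ N ih =>
    have e1 : qp q (x / q^(N+1)) (2*(N+1)) = (1 - x / q^(N+1)) * qp q (x/q^N) (2*N) * (1 - x * q^N) := by
      rw [show 2*(N+1) = (2*N+1)+1 by ring]
      unfold qp
      rw [Finset.prod_range_succ, Finset.prod_range_succ']
      have : ∀ k, 1 - x / q^(N+1) * q^(k+1) = 1 - x/q^N * q^k := by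
        intro k
        field_simp
        ring
      simp only [this]
      have h2 : x / q^N * q^(2*N) = x * q^N := by
        field_simp
        ring
      rw [h2]
      ring
    have e2 : ∀ z, qp q z (N+1) = qp q z N * (1 - z * q^N) := fun z => by simp [qp, Finset.prod_range_succ]
    have e3 : q^(-(tri ((N+1:ℕ)+1))) = q^(-(tri (N+1))) * (q^(N+1))⁻¹ := by
      rw [← zpow_natCast q (N+1), ← zpow_neg, ← zpow_add₀ h0.ne']
      congr 1
      have a1 := two_tri ((N:ℤ)+1)
      have a2 := two_tri (((N+1:ℕ):ℤ)+1)
      push_cast at *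
      linarith
    rw [e1, ih, e2, e2, e3]
    field_simp
    ring

lemma finite_jtp {q x : ℝ} (h0 : 0 < q) (h1 : q < 1) (hx : 0 < x) (N : ℕ) :
    beta q (fun m => (-x)^m * q^(tri m)) N = qp q x N * qp q (q/x) N / PP q (2*N) := by
  have hb := qbinom h0 h1 (x/q^N) (2*N)
  rw [prod_shift h0 hx] at hb
  have hx' : (-x) ≠ 0 := by linarith
  have hne : (-x)^N * q^(-(tri (N+1))) ≠ 0 :=
    mul_ne_zero (pow_ne_zero _ hx') (zpow_ne_zero _ h0.ne')
  apply mul_left_cancel₀ hne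
  rw [← mul_div_assoc, ← hb, beta, Finset.mul_sum]
  symm
  refine Finset.sum_bij (fun (j:ℕ) _ => (j:ℤ) - N) ?_ ?_ ?_ ?_
  · intro j hj
    simp only [Finset.mem_range, Finset.mem_Icc] at *
    omega
  · intro a _ b _ h
    omega
  · intro b hb
    simp only [Finset.mem_Icc] at hb
    exact ⟨(b + N).toNat, by simp only [Finset.mem_range]; omega, by omega⟩
  · intro j hj
    simp only [Finset.mem_range] at hj
    have hc : cc q N ((j:ℤ) - N) = 1 / (PP q j * PP q (2*N-j)) := by
      unfold cc
      rw [if_pos (by omega)]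
      rcases le_total j N with h | h
      · rw [show N - ((j:ℤ)-N).natAbs = j by omega, show N + ((j:ℤ)-N).natAbs = 2*N-j by omega]
      · rw [show N - ((j:ℤ)-N).natAbs = 2*N-j by omega, show N + ((j:ℤ)-N).natAbs = j by omega, mul_comm (PP q j)]
    rw [hc]
    have e1 : -(x/q^N) = (-x) * q^(-(N:ℤ)) := by
      rw [zpow_neg, zpow_natCast]; ring
    have key : (-(x/q^N))^j * q^(j.choose 2) = (-x)^N * q^(-(tri (N+1))) * ((-x)^((j:ℤ)-N) * q^(tri ((j:ℤ)-N))) := by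
      rw [e1, mul_pow, ← zpow_natCast (-x) j, ← zpow_natCast q (j.choose 2), ← zpow_natCast (q^(-(N:ℤ))) j, ← zpow_natCast (-x) N, ← zpow_mul]
      have : (-x)^(j:ℤ) = (-x)^(N:ℤ) * (-x)^((j:ℤ)-N) := by
        rw [← zpow_add₀ hx']; congr 1; ring
      rw [this, mul_assoc, ← zpow_add₀ h0.ne']
      have : q ^ (-(N:ℤ) * j + ((j.choose 2 : ℕ):ℤ)) = q^(-(tri (N+1))) * q^(tri ((j:ℤ)-N)) := by
        rw [← zpow_add₀ h0.ne', choose_tri]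
        congr 1
        have a1 := two_tri ((N:ℤ)+1)
        have a2 := two_tri ((j:ℤ)-N)
        have a3 := two_tri (j:ℤ)
        linarith
      rw [this]; ring
    rw [key]; ring

noncomputable def aa (q : ℝ) (m : ℤ) : ℝ := (-1)^m * q^(5 * tri m + 2 * m)

lemma beta_unit {q : ℝ} (h0 : 0 < q) (h1 : q < 1) (N : ℕ) :
    beta q (fun m => (-1)^m * q^(tri m)) N = if N = 0 then 1 else 0 := by
  rw [finite_jtp h0 h1 one_pos]
  cases N with
  | zero => simp [qp, PP_zero]
  | succ n => simp [qp, Finset.prod_range_succ']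

lemma finiteA {q : ℝ} (h0 : 0 < q) (h1 : q < 1) (N : ℕ) :
    beta q (aa q) N = ∑ s ∈ Finset.range (N+1), q^(s^2) / PP q (N-s) * (1 / PP q s) := by
  have e : aa q = fun m => q^(m.natAbs^2) * (q^(m.natAbs^2) * ((-1)^m * q^(tri m))) := by
    funext m
    unfold aa
    rw [← zpow_natCast q (m.natAbs^2)]
    have : 5 * tri m + 2 * m = ((m.natAbs^2 : ℕ):ℤ) + ((m.natAbs^2 : ℕ):ℤ) + tri m := by
      have := two_tri m
      push_cast
      rw [sq_abs]
      linarith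
    rw [this, zpow_add₀ h0.ne', zpow_add₀ h0.ne']
    ring
  rw [e, bailey h0 h1]
  refine Finset.sum_congr rfl fun s _ => ?_
  congr 1
  rw [bailey h0 h1, Finset.sum_range_succ']
  simp [beta_unit h0 h1]

lemma finiteB {q : ℝ} (h0 : 0 < q) (h1 : q < 1) (N : ℕ) :
    beta (q^5) (aa q) N = qp (q^5) (q^2) N * qp (q^5) (q^3) N / PP (q^5) (2*N) := by
  have h := finite_jtp (q := q^5) (x := q^2) (by positivity) (pow_lt_one₀ h0.le h1 (by omega)) (by positivity) N
  rw [show q^5/q^2 = q^3 by field_simp] at h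
  rw [← h]
  congr 1
  funext m
  unfold aa
  rw [neg_eq_neg_one_mul (q^2), mul_zpow, mul_assoc, ← zpow_natCast q 2, ← zpow_natCast q 5, ← zpow_mul, ← zpow_mul, ← zpow_add₀ h0.ne']
  congr 2
  push_cast; ring

open Filter Topology

lemma tannery_range {G : ℕ → ℕ → ℝ} {g b : ℕ → ℝ} (hb : Summable b)
    (hG : ∀ N, Tendsto (fun K => G K N) atTop (𝓝 (g N)))
    (hbd : ∀ K N, N ≤ K → |G K N| ≤ b N) :
    Tendsto (fun K => ∑ N ∈ Finset.range (K+1), G K N) atTop (𝓝 (∑' N, g N)) := by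
  have hb0 : ∀ N, 0 ≤ b N := fun N => (abs_nonneg _).trans (hbd N N le_rfl)
  have h := tendsto_tsum_of_dominated_convergence (𝓕 := atTop)
    (f := fun K N => if N ≤ K then G K N else 0) (g := g) hb ?_ ?_
  · refine h.congr fun K => ?_
    rw [tsum_eq_sum (s := Finset.range (K+1))]
    · refine Finset.sum_congr rfl fun N hN => ?_
      rw [if_pos (by simpa [Nat.lt_succ_iff] using hN)]
    · intro N hN
      rw [if_neg (by simpa [Nat.lt_succ_iff] using hN)]
  · intro N
    refine (hG N).congr' ?_
    filter_upwards [eventually_ge_atTop N] with K hK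
    rw [if_pos hK]
  · refine Eventually.of_forall fun K N => ?_
    split_ifs with h
    · exact hbd K N h
    · simpa using hb0 N

lemma tendsto_sub_nat (s : ℕ) : Tendsto (fun N : ℕ => N - s) atTop atTop :=
  tendsto_sub_atTop_nat s

lemma qp_summable {q : ℝ} (h0 : 0 < q) (h1 : q < 1) (a : ℝ) : Summable fun k : ℕ => ‖-(a * q^k)‖ := by
  simp only [norm_neg, norm_mul, norm_pow, Real.norm_of_nonneg h0.le]
  exact (summable_geometric_of_lt_one h0.le h1).mul_left _

lemma qp_tendsto_s10 {q : ℝ} (h0 : 0 < q) (h1 : q < 1) (a : ℝ) :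
    Tendsto (qp q a) atTop (𝓝 (qpi q a)) := by
  have := multipliable_one_add_of_summable (qp_summable h0 h1 a)
  simp only [← sub_eq_add_neg] at this
  exact this.tendsto_prod_tprod_nat

lemma qpi_ne {q a : ℝ} (h0 : 0 < q) (h1 : q < 1) (ha : a < 1) : qpi q a ≠ 0 := by
  have := tprod_one_add_ne_zero_of_summable (f := fun k : ℕ => -(a*q^k)) ?_ (qp_summable h0 h1 a)
  · simpa only [← sub_eq_add_neg, qpi] using this
  · intro k
    have h2 : q^k ≤ 1 := pow_le_one₀ h0.le h1.le
    have h3 : 0 < q^k := by positivity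
    have : a * q^k < 1 := by
      rcases le_total a 0 with h | h
      · nlinarith
      · nlinarith
    linarith

lemma PP_anti {q : ℝ} (h0 : 0 < q) (h1 : q < 1) : Antitone (PP q) := by
  refine antitone_nat_of_succ_le fun n => ?_
  rw [PP_succ]
  have := PP_pos h0 h1 n
  have : 0 < q^(n+1) := by positivity
  nlinarith

lemma PP_tendsto {q : ℝ} (h0 : 0 < q) (h1 : q < 1) : Tendsto (PP q) atTop (𝓝 (qpi q q)) :=
  qp_tendsto_s10 h0 h1 q

lemma L_le {q : ℝ} (h0 : 0 < q) (h1 : q < 1) (n : ℕ) : qpi q q ≤ PP q n :=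
  (PP_anti h0 h1).le_of_tendsto (PP_tendsto h0 h1) n

lemma L_pos {q : ℝ} (h0 : 0 < q) (h1 : q < 1) : 0 < qpi q q :=
  lt_of_le_of_ne (ge_of_tendsto' (PP_tendsto h0 h1) fun n => (PP_pos h0 h1 n).le) (qpi_ne h0 h1 h1).symm

lemma cc_nonneg {q : ℝ} (h0 : 0 < q) (h1 : q < 1) (N : ℕ) (m : ℤ) : 0 ≤ cc q N m := by
  unfold cc
  split_ifs
  · have := PP_pos h0 h1 (N - m.natAbs)
    have := PP_pos h0 h1 (N + m.natAbs)
    positivity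
  · exact le_rfl

lemma cc_le {q : ℝ} (h0 : 0 < q) (h1 : q < 1) (N : ℕ) (m : ℤ) :
    cc q N m ≤ 1 / (qpi q q * qpi q q) := by
  have hL := L_pos h0 h1
  unfold cc
  split_ifs
  · exact one_div_le_one_div_of_le (by positivity) (mul_le_mul (L_le h0 h1 _) (L_le h0 h1 _) hL.le (PP_pos h0 h1 _).le)
  · positivity

lemma cc_tendsto {q : ℝ} (h0 : 0 < q) (h1 : q < 1) (m : ℤ) :
    Tendsto (fun N => cc q N m) atTop (𝓝 (1 / (qpi q q * qpi q q))) := by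
  have hL := L_pos h0 h1
  have : Tendsto (fun N => 1 / (PP q (N - m.natAbs) * PP q (N + m.natAbs))) atTop (𝓝 (1 / (qpi q q * qpi q q))) := by
    refine tendsto_const_nhds.div (Tendsto.mul ?_ ?_) (by positivity)
    · exact (PP_tendsto h0 h1).comp (tendsto_sub_nat _)
    · exact (PP_tendsto h0 h1).comp (tendsto_add_atTop_nat _)
  refine this.congr' ?_
  filter_upwards [eventually_ge_atTop m.natAbs] with N hN
  rw [cc, if_pos hN]

lemma beta_tendsto {q : ℝ} (h0 : 0 < q) (h1 : q < 1) {α : ℤ → ℝ} (hα : Summable fun m => |α m|) :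
    Tendsto (beta q α) atTop (𝓝 ((∑' m, α m) * (1 / (qpi q q * qpi q q)))) := by
  rw [← tsum_mul_right]
  have h := tendsto_tsum_of_dominated_convergence (𝓕 := atTop)
    (f := fun N m => α m * cc q N m) (g := fun m => α m * (1 / (qpi q q * qpi q q)))
    (hα.mul_right (1 / (qpi q q * qpi q q))) ?_ ?_
  · refine h.congr fun N => ?_
    rw [beta, tsum_eq_sum]
    intro m hm
    simp only [Finset.mem_Icc] at hm
    rw [cc, if_neg (by omega), mul_zero]
  · intro m
    exact (cc_tendsto h0 h1 m).const_mul _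
  · refine Eventually.of_forall fun N m => ?_
    rw [Real.norm_eq_abs, abs_mul, abs_of_nonneg (cc_nonneg h0 h1 N m)]
    exact mul_le_mul_of_nonneg_left (cc_le h0 h1 N m) (abs_nonneg _)

lemma aa_summable {q : ℝ} (h0 : 0 < q) (h1 : q < 1) : Summable fun m => |aa q m| := by
  have hb : Summable fun m : ℤ => q^m.natAbs := by
    apply Summable.of_nat_of_neg
    · simpa using summable_geometric_of_lt_one h0.le h1
    · simpa using summable_geometric_of_lt_one h0.le h1
  refine hb.of_nonneg_of_le (fun _ => abs_nonneg _) fun m => ?_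
  unfold aa
  rw [abs_mul, abs_zpow, abs_neg, abs_one, one_zpow, one_mul, abs_of_pos (by positivity), ← zpow_natCast]
  apply zpow_le_zpow_right_of_le_one₀ h0 h1.le
  have := two_tri m
  push_cast
  rcases abs_cases m with ⟨h, h'⟩ | ⟨h, h'⟩ <;> rw [h]
  · rcases h'.eq_or_lt with h2 | h2
    · subst h2; simp [tri]
    · have : 0 ≤ m * (m-1) := mul_nonneg h' (by omega)
      linarith
  · nlinarith

lemma term_summable {q r : ℝ} (h0 : 0 < q) (h1 : q < 1) :
    Summable fun n : ℕ => q^(n^2) * r := by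
  have h : Summable fun n : ℕ => q^(n^2) := by
    refine (summable_geometric_of_lt_one h0.le h1).of_nonneg_of_le (fun _ => by positivity) fun n => ?_
    apply pow_le_pow_of_le_one h0.le h1.le
    nlinarith [Nat.zero_le n, n.le_self_pow (n := 2) (by omega)]
  exact h.mul_right _

lemma rr_A {q : ℝ} (h0 : 0 < q) (h1 : q < 1) :
    (∑' m, aa q m) = qpi q q * ∑' s : ℕ, q^(s^2) / PP q s := by
  have hL := L_pos h0 h1
  have t1 := beta_tendsto h0 h1 (aa_summable h0 h1)
  have t2 : Tendsto (beta q (aa q)) atTop (𝓝 (∑' s : ℕ, q^(s^2) / qpi q q * (1 / PP q s))) := by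
    rw [show beta q (aa q) = _ from funext (finiteA h0 h1)]
    refine tannery_range (b := fun s => q^(s^2) * (1 / (qpi q q * qpi q q))) (term_summable h0 h1) ?_ ?_
    · intro s
      exact (tendsto_const_nhds.div ((PP_tendsto h0 h1).comp (tendsto_sub_nat s)) hL.ne').mul_const _
    · intro K s _
      have a1 := PP_pos h0 h1 (K-s)
      have a2 := PP_pos h0 h1 s
      rw [abs_of_pos (by positivity)]
      calc _ = q^(s^2) * (1 / (PP q (K-s) * PP q s)) := by field_simp
        _ ≤ _ := by
          refine mul_le_mul_of_nonneg_left ?_ (by positivity)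
          exact one_div_le_one_div_of_le (by positivity) (mul_le_mul (L_le h0 h1 _) (L_le h0 h1 _) hL.le a1.le)
  have e := tendsto_nhds_unique t1 t2
  have e3 : (∑' s : ℕ, q^(s^2) / qpi q q * (1 / PP q s)) = (∑' s : ℕ, q^(s^2) / PP q s) * (1 / qpi q q) := by
    rw [← tsum_mul_right]
    exact tsum_congr fun s => by ring
  rw [e3] at e
  field_simp at e
  linarith

lemma rr_B {q : ℝ} (h0 : 0 < q) (h1 : q < 1) :
    (∑' m, aa q m) = qpi (q^5) (q^5) * (qpi (q^5) (q^2) * qpi (q^5) (q^3)) := by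
  have a0 : 0 < q^5 := by positivity
  have a1 : q^5 < 1 := pow_lt_one₀ h0.le h1 (by omega)
  have hL := L_pos a0 a1
  have t1 := beta_tendsto a0 a1 (aa_summable h0 h1)
  have t2 : Tendsto (beta (q^5) (aa q)) atTop (𝓝 (qpi (q^5) (q^2) * qpi (q^5) (q^3) / qpi (q^5) (q^5))) := by
    rw [show beta (q^5) (aa q) = _ from funext (finiteB h0 h1)]
    refine ((qp_tendsto_s10 a0 a1 _).mul (qp_tendsto_s10 a0 a1 _)).div ((PP_tendsto a0 a1).comp ?_) hL.ne'
    exact tendsto_atTop_mono (fun n => by simp only [id]; omega) tendsto_id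
  have e := tendsto_nhds_unique t1 t2
  field_simp at e
  linarith

lemma rr_C {q : ℝ} (h0 : 0 < q) (h1 : q < 1) :
    qpi q q = qpi (q^5) q * qpi (q^5) (q^2) * qpi (q^5) (q^3) * qpi (q^5) (q^4) * qpi (q^5) (q^5) := by
  have a0 : 0 < q^5 := by positivity
  have a1 : q^5 < 1 := pow_lt_one₀ h0.le h1 (by omega)
  have t1 : Tendsto (fun N => PP q (5*N)) atTop (𝓝 (qpi q q)) :=
    (PP_tendsto h0 h1).comp (tendsto_atTop_mono (fun n => by simp only [id]; omega) tendsto_id)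
  have t2 := ((((qp_tendsto_s10 a0 a1 q).mul (qp_tendsto_s10 a0 a1 (q^2))).mul (qp_tendsto_s10 a0 a1 (q^3))).mul
    (qp_tendsto_s10 a0 a1 (q^4))).mul (qp_tendsto_s10 a0 a1 (q^5))
  refine tendsto_nhds_unique t1 (t2.congr fun N => ?_)
  induction N with
  | zero => simp [qp, PP_zero]
  | succ N ih =>
    have e2 : ∀ z, qp (q^5) z (N+1) = qp (q^5) z N * (1 - z * (q^5)^N) := fun z => by simp [qp, Finset.prod_range_succ]
    rw [show 5 * (N+1) = 5*N+1+1+1+1+1 by ring]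
    simp only [PP_succ, e2]
    rw [← ih]
    ring

lemma qp_split (r a : ℝ) (n m : ℕ) : qp r a (n+m) = qp r a n * qp r (a * r^n) m := by
  unfold qp
  rw [Finset.prod_range_add]
  congr 1
  exact Finset.prod_congr rfl fun k _ => by ring

lemma qpneg_pos {r : ℝ} (h0 : 0 < r) (n : ℕ) : 1 ≤ qp r (-r) n := by
  induction n with
  | zero => simp [qp]
  | succ n ih =>
    rw [show qp r (-r) (n+1) = qp r (-r) n * (1 - (-r) * r^n) by simp [qp, Finset.prod_range_succ]]
    have : 0 < r * r^n := by positivity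
    nlinarith

noncomputable def ff (q : ℝ) (K n m : ℕ) : ℝ :=
  q^((n+m)^2) * q^m / (PP (q^2) n * PP (q^2) m) * (PP (q^2) (K-n) / PP (q^2) (K-(n+m)))

lemma finiteD {q : ℝ} (h0 : 0 < q) (h1 : q < 1) (K : ℕ) :
    qp (q^2) (-q^2) K * ∑ n ∈ Finset.range (K+1), q^(n^2) / (PP (q^2) n * qp (q^2) (-q^2) n) =
      ∑ N ∈ Finset.range (K+1), ∑ k ∈ Finset.range (N+1), ff q K k (N-k) := by
  obtain ⟨a0, a1⟩ := sq_ne h0 h1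
  rw [Finset.sum_range_diag_flip, Finset.mul_sum]
  refine Finset.sum_congr rfl fun n hn => ?_
  have hn : n ≤ K := by simpa [Nat.lt_succ_iff] using hn
  obtain ⟨d, rfl⟩ := Nat.exists_eq_add_of_le hn
  rw [show n + d + 1 - n = d + 1 by omega, qp_split]
  have hb := qbinom a0 a1 (-q^2 * (q^2)^n) d
  have p1 := (PP_pos a0 a1 d).ne'
  have p2 := (PP_pos a0 a1 n).ne'
  have p3 : qp (q^2) (-q^2) n ≠ 0 := by linarith [qpneg_pos a0 n]
  rw [eq_div_iff p1] at hb
  rw [← hb, Finset.sum_mul, Finset.mul_sum, Finset.sum_mul]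
  refine Finset.sum_congr rfl fun m hm => ?_
  have hm : m ≤ d := by simpa [Nat.lt_succ_iff] using hm
  unfold ff
  rw [show n + d - n = d by omega, show n + d - (n+m) = d - m by omega]
  have p4 := (PP_pos a0 a1 m).ne'
  have p5 := (PP_pos a0 a1 (d-m)).ne'
  have e1 : (q^2)^(m.choose 2) * q^m = q^(m^2) := by
    rw [← pow_mul, ← pow_add]
    congr 1
    have c := choose_tri m
    have c2 := two_tri m
    zify
    rw [c]; linarith
  have e2 : (-(-q^2 * (q^2)^n))^m * (q^2)^(m.choose 2) * q^(n^2) = q^((n+m)^2) * q^m := by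
    have : (-(-q^2 * (q^2)^n))^m = q^m * q^m * q^(2*n*m) := by ring
    rw [this]
    calc _ = q^m * q^(2*n*m) * q^(n^2) * ((q^2)^(m.choose 2) * q^m) := by ring
      _ = _ := by rw [e1]; ring
  rw [← e2]
  field_simp

lemma rr_D {q : ℝ} (h0 : 0 < q) (h1 : q < 1) :
    qpi (q^2) (-q^2) * ∑' n : ℕ, q^(n^2) / (PP (q^2) n * qp (q^2) (-q^2) n) =
      ∑' N : ℕ, q^(N^2) / PP q N := by
  obtain ⟨a0, a1⟩ := sq_ne h0 h1
  have hL := L_pos h0 h1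
  have hL2 := L_pos a0 a1
  have t1 : Tendsto (fun K => qp (q^2) (-q^2) K * ∑ n ∈ Finset.range (K+1), q^(n^2) / (PP (q^2) n * qp (q^2) (-q^2) n))
      atTop (𝓝 (qpi (q^2) (-q^2) * ∑' n : ℕ, q^(n^2) / (PP (q^2) n * qp (q^2) (-q^2) n))) := by
    refine (qp_tendsto_s10 a0 a1 _).mul ?_
    refine tannery_range (b := fun n => q^(n^2) * (1 / qpi (q^2) (q^2))) (term_summable h0 h1)
      (fun N => tendsto_const_nhds) fun _ n _ => ?_
    have p1 := PP_pos a0 a1 n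
    have p2 := qpneg_pos a0 n
    have p3 := L_le a0 a1 n
    rw [abs_of_nonneg (by positivity), div_eq_mul_one_div]
    refine mul_le_mul_of_nonneg_left ?_ (by positivity)
    exact one_div_le_one_div_of_le hL2 (by nlinarith)
  simp only [finiteD h0 h1] at t1
  refine tendsto_nhds_unique t1 ?_
  have hsum : ∀ N : ℕ, ∑ k ∈ Finset.range (N+1), q^(N^2) * q^(N-k) / (PP (q^2) k * PP (q^2) (N-k)) = q^(N^2) / PP q N := by
    intro N
    rw [div_eq_mul_one_div, ← rs_sum h0 h1, ← Finset.sum_range_reflect, Finset.mul_sum]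
    refine Finset.sum_congr rfl fun k hk => ?_
    have hk : k ≤ N := by simpa [Nat.lt_succ_iff] using hk
    rw [show N + 1 - 1 - k = N - k by omega, show N - (N - k) = k by omega]
    ring
  refine tannery_range (b := fun n => q^(n^2) * (1 / qpi q q)) (term_summable h0 h1) ?_ ?_
  · intro N
    rw [← hsum N]
    refine tendsto_finsetSum _ fun k hk => ?_
    have hk : k ≤ N := by simpa [Nat.lt_succ_iff] using hk
    unfold ff
    rw [show k + (N-k) = N by omega]
    have := ((PP_tendsto a0 a1).comp (tendsto_sub_nat k)).div ((PP_tendsto a0 a1).comp (tendsto_sub_nat N)) hL2.ne'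
    rw [div_self hL2.ne'] at this
    simpa using this.const_mul (q^(N^2) * q^(N-k) / (PP (q^2) k * PP (q^2) (N-k)))
  · intro K N hN
    have hp := PP_pos a0 a1
    have hpos : ∀ k, 0 ≤ ff q K k (N-k) := fun k => by
      unfold ff
      have := hp k; have := hp (N-k); have := hp (K-k); have := hp (K-(k+(N-k)))
      positivity
    rw [abs_of_nonneg (Finset.sum_nonneg fun k _ => hpos k)]
    calc _ ≤ ∑ k ∈ Finset.range (N+1), q^(N^2) * q^(N-k) / (PP (q^2) k * PP (q^2) (N-k)) := by
          refine Finset.sum_le_sum fun k hk => ?_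
          have hk : k ≤ N := by simpa [Nat.lt_succ_iff] using hk
          unfold ff
          rw [show k + (N-k) = N by omega]
          have := hp k; have := hp (N-k)
          refine mul_le_of_le_one_right (by positivity) ?_
          rw [div_le_one (hp _)]
          exact PP_anti a0 a1 (by omega)
      _ = q^(N^2) * (1 / PP q N) := by rw [hsum]; ring
      _ ≤ _ := mul_le_mul_of_nonneg_left (one_div_le_one_div_of_le hL (L_le h0 h1 N)) (by positivity)

theorem rr_first_new_form (q : ℝ) (hq0 : 0 < q) (hq1 : q < 1) :
    1 / (qpi (q ^ 5) q * qpi (q ^ 5) (q ^ 4)) =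
      qpi (q ^ 2) (-q ^ 2) *
        ∑' n : ℕ, q ^ (n ^ 2) / (qp (q ^ 2) (q ^ 2) n * qp (q ^ 2) (-q ^ 2) n) := by
  have hD := rr_D hq0 hq1
  simp only [PP] at hD
  rw [hD]
  have hA := rr_A hq0 hq1
  simp only [PP] at hA
  rw [rr_B hq0 hq1, rr_C hq0 hq1] at hA
  have a0 : 0 < q^5 := by positivity
  have a1 : ∀ n : ℕ, q^(n+1) < 1 := fun n => pow_lt_one₀ hq0.le hq1 (by omega)
  have n1 := qpi_ne a0 (a1 4) hq1
  have n2 := qpi_ne a0 (a1 4) (a1 1)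
  have n3 := qpi_ne a0 (a1 4) (a1 2)
  have n4 := qpi_ne a0 (a1 4) (a1 3)
  have n5 := qpi_ne a0 (a1 4) (a1 4)
  norm_num at n2 n3 n4 n5
  rw [div_eq_iff (mul_ne_zero n1 n4)]
  apply mul_left_cancel₀ (mul_ne_zero n5 (mul_ne_zero n2 n3))
  rw [mul_one]
  exact hA.trans (by ring)
end
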